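/- arXiv:1511.02387 — 2 statements merged into one kernel-verified Lean document; each statement's English description precedes it below -/
import Mathlib

section
/- For all sufficiently large n, there exists an irreducible finite-dimensional complex representation V of the symmetric group S_n such that every irreducible finite-dimensional complex representation of S_n is a constituent of the fourfold tensor power V ⊗ V ⊗ V ⊗ V. (Formally: there exists N such that for every n ≥ N such a V exists.) -/
open CategoryTheory MonoidalCategory

section Characters

variable {G : Type} [Group G]

theorem norm_trace_le_finrank_of_pow_eq_one {V : Type*} [AddCommGroup V] [Module ℂ V]
    [FiniteDimensional ℂ V] {f : Module.End ℂ V} {m : ℕ} (hm : m ≠ 0) (hf : f ^ m = 1) :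
    ‖LinearMap.trace ℂ V f‖ ≤ Module.finrank ℂ V := by
  have hroots : ∀ μ ∈ f.charpoly.roots, ‖μ‖ ≤ 1 := by
    intro μ hμ
    obtain ⟨v, hv⟩ := (Module.End.hasEigenvalue_iff_isRoot_charpoly f μ).mpr
      (Polynomial.isRoot_of_mem_roots hμ) |>.exists_hasEigenvector
    have h1 := hv.pow_apply m
    rw [hf, Module.End.one_apply] at h1
    have h2 : μ ^ m = 1 := by
      have : (μ ^ m - 1) • v = 0 := by rw [sub_smul, one_smul, ← h1, sub_self]
      exact sub_eq_zero.mp ((smul_eq_zero.mp this).resolve_right hv.2)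
    exact (Complex.norm_eq_one_of_pow_eq_one h2 hm).le
  rw [Module.End.trace_eq_sum_roots_charpoly_of_splits (IsAlgClosed.splits _)]
  calc ‖f.charpoly.roots.sum‖ ≤ (f.charpoly.roots.map norm).sum := norm_multiset_sum_le _
    _ ≤ (f.charpoly.roots.map norm).card • (1 : ℝ) := by
        refine Multiset.sum_le_card_nsmul _ _ fun x hx ↦ ?_
        obtain ⟨μ, hμ, rfl⟩ := Multiset.mem_map.mp hx
        exact hroots μ hμ
    _ ≤ Module.finrank ℂ V := by
        rw [Multiset.card_map, nsmul_one, ← f.charpoly_natDegree]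
        exact_mod_cast Polynomial.card_roots' _

theorem Representation.character_eq_add_of_isCompl {V : Type*} [AddCommGroup V] [Module ℂ V]
    [FiniteDimensional ℂ V] {ρ : Representation ℂ G V} {p q : Subrepresentation ρ}
    (h : IsCompl p q) (g : G) :
    ρ.character g = p.toRepresentation.character g + q.toRepresentation.character g := by
  have hpq : IsCompl p.toSubmodule q.toSubmodule := by
    constructor
    · rw [disjoint_iff, ← Subrepresentation.toSubmodule_inf, h.inf_eq_bot]; rfl
    · rw [codisjoint_iff, ← Subrepresentation.toSubmodule_sup, h.sup_eq_top]; rfl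
  let N : Bool → Submodule ℂ V := fun b ↦ bif b then p.toSubmodule else q.toSubmodule
  have hN : DirectSum.IsInternal N := by
    rw [DirectSum.isInternal_submodule_iff_isCompl N (i := true) (j := false) (by simp)
      (by ext b; cases b <;> simp)]
    exact hpq
  have hf : ∀ b, Set.MapsTo (ρ g) (N b) (N b) := by
    rintro (_ | _)
    · exact q.apply_mem_toSubmodule g
    · exact p.apply_mem_toSubmodule g
  exact (LinearMap.trace_eq_sum_trace_restrict hN hf).trans (Fintype.sum_bool _)

variable [Fintype G]

theorem FDRep.norm_character_le (V : FDRep ℂ G) (g : G) :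
    ‖V.character g‖ ≤ Module.finrank ℂ V := by
  refine norm_trace_le_finrank_of_pow_eq_one (m := Fintype.card G) Fintype.card_ne_zero ?_
  rw [← map_pow, pow_card_eq_one, map_one]

theorem FDRep.simple_of_isIrreducible {V : Type} [AddCommGroup V] [Module ℂ V]
    [FiniteDimensional ℂ V] (ρ : Representation ℂ G V) [ρ.IsIrreducible] :
    Simple (FDRep.of ρ) := by
  classical
  have := invertibleOfNonzero (NeZero.ne (Nat.card G : ℂ))
  rw [FDRep.simple_iff_char_is_norm_one]
  have h := Representation.char_orthonormal ρ ρ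
  rw [if_pos ⟨Representation.Equiv.refl ρ⟩, inv_mul_eq_one₀ (NeZero.ne _)] at h
  exact h.symm

/-- The set of irreducible complex characters of `G`. -/
def irreducibleCharacters (G : Type) [Group G] : Set (G → ℂ) :=
  {χ | ∃ V : FDRep ℂ G, Simple V ∧ V.character = χ}

theorem exists_character_eq_sum_irreducibleCharacters {V : Type} [AddCommGroup V] [Module ℂ V]
    [FiniteDimensional ℂ V] (ρ : Representation ℂ G V) :
    ∃ L : Multiset (G → ℂ), (∀ χ ∈ L, χ ∈ irreducibleCharacters G) ∧ ρ.character = L.sum := by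
  induction hn : Module.finrank ℂ V using Nat.strong_induction_on generalizing V with
  | _ n ih =>
  subst hn
  by_cases hV : Subsingleton V
  · refine ⟨0, by simp, ?_⟩
    ext g
    have : ρ g = 0 := Subsingleton.elim _ _
    simp [Representation.character, this]
  by_cases hρ : ρ.IsIrreducible
  · exact ⟨{ρ.character}, by
      simpa using ⟨FDRep.of ρ, FDRep.simple_of_isIrreducible ρ, rfl⟩, by simp⟩
  obtain ⟨p, hp0, hp1⟩ : ∃ p : Subrepresentation ρ, p ≠ ⊥ ∧ p ≠ ⊤ := by
    by_contra! hp
    refine hρ { exists_pair_ne := ⟨⊥, ⊤, fun h ↦ hV ?_⟩, eq_bot_or_eq_top := fun a ↦ ?_ }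
    · have := congrArg Subrepresentation.toSubmodule h
      exact (Submodule.subsingleton_iff ℂ).mp (subsingleton_of_bot_eq_top this)
    · exact or_iff_not_imp_left.mpr (hp a)
  obtain ⟨q, hpq⟩ := exists_isCompl p
  have hq1 : q ≠ ⊤ := by
    rintro rfl
    exact hp0 (by simpa using hpq.inf_eq_bot)
  have hlt : ∀ r : Subrepresentation ρ, r ≠ ⊤ →
      Module.finrank ℂ r.toSubmodule < Module.finrank ℂ V := fun r hr ↦
    Submodule.finrank_lt fun h ↦ hr (Subrepresentation.toSubmodule_injective h)
  obtain ⟨L, hL, hLs⟩ := ih _ (hlt p hp1) p.toRepresentation rfl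
  obtain ⟨M, hM, hMs⟩ := ih _ (hlt q hq1) q.toRepresentation rfl
  refine ⟨L + M, fun χ hχ ↦ (Multiset.mem_add.mp hχ).elim (hL χ) (hM χ), ?_⟩
  rw [Multiset.sum_add, ← hLs, ← hMs]
  ext g
  exact Representation.character_eq_add_of_isCompl hpq g

theorem sum_mul_inv_of_mem_irreducibleCharacters {χ ψ : G → ℂ}
    (hχ : χ ∈ irreducibleCharacters G) (hψ : ψ ∈ irreducibleCharacters G) [Decidable (χ = ψ)] :
    ∑ g, χ g * ψ g⁻¹ = if χ = ψ then (Fintype.card G : ℂ) else 0 := by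
  obtain ⟨V, hV, rfl⟩ := hχ
  obtain ⟨W, hW, rfl⟩ := hψ
  split_ifs with h
  · rw [← h, (FDRep.simple_iff_char_is_norm_one V).mp hV, Nat.card_eq_fintype_card]
  · have := invertibleOfNonzero (NeZero.ne (Nat.card G : ℂ))
    have h1 := FDRep.char_orthonormal V W
    rw [if_neg fun ⟨i⟩ ↦ h (FDRep.char_iso i)] at h1
    exact (mul_eq_zero.mp h1).resolve_left (inv_ne_zero (NeZero.ne _))

open scoped Matrix ComplexOrder in
theorem Matrix.trace_map_inv_eq_star {n : Type*} [Fintype n] [DecidableEq n]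
    (φ : G →* Matrix n n ℂ) (g : G) : (φ g⁻¹).trace = star (φ g).trace := by
  classical
  set H : Matrix n n ℂ := ∑ h, (φ h)ᴴ * φ h with hH
  have hpos : H.PosDef := by
    rw [hH, ← Finset.add_sum_erase _ _ (Finset.mem_univ (1 : G))]
    refine Matrix.PosDef.add_posSemidef (by simpa using Matrix.PosDef.one) ?_
    exact Matrix.posSemidef_sum _ fun h _ ↦ Matrix.posSemidef_conjTranspose_mul_self _
  have hinv : (φ g)ᴴ * H * φ g = H := by
    rw [hH, Finset.mul_sum, Finset.sum_mul]
    refine Fintype.sum_equiv (Equiv.mulRight g) _ _ fun h ↦ ?_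
    simp [Matrix.mul_assoc, Matrix.conjTranspose_mul]
  have hφ : φ g * φ g⁻¹ = 1 := by rw [← map_mul, mul_inv_cancel, map_one]
  have hdet : IsUnit H.det := (Matrix.isUnit_iff_isUnit_det H).mp hpos.isUnit
  have key : φ g⁻¹ = H⁻¹ * ((φ g)ᴴ * H) := by
    conv_rhs => rw [← Matrix.mul_one ((φ g)ᴴ * H), ← hφ, ← Matrix.mul_assoc _ (φ g), hinv]
    rw [← Matrix.mul_assoc, Matrix.nonsing_inv_mul H hdet, Matrix.one_mul]
  rw [key, Matrix.trace_mul_comm, Matrix.mul_assoc, Matrix.mul_nonsing_inv H hdet, Matrix.mul_one,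
    Matrix.trace_conjTranspose]

theorem FDRep.character_inv (V : FDRep ℂ G) (g : G) :
    V.character g⁻¹ = star (V.character g) := by
  let b := Module.finBasis ℂ V
  have h := Matrix.trace_map_inv_eq_star
    ((LinearMap.toMatrixAlgEquiv b).toMulEquiv.toMonoidHom.comp V.ρ) g
  simpa [FDRep.character, LinearMap.trace_eq_matrix_trace ℂ b, LinearMap.toMatrixAlgEquiv] using h

/-- The left regular representation of `G` on complex functions. -/
noncomputable def regularRepresentation (G : Type) [Group G] : Representation ℂ G (G → ℂ) where
  toFun g := LinearMap.funLeft ℂ ℂ (g⁻¹ * ·)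
  map_one' := by ext; simp [LinearMap.funLeft]
  map_mul' g h := by ext; simp [LinearMap.funLeft, mul_assoc]

theorem regularRepresentation_character [DecidableEq G] (g : G) :
    (regularRepresentation G).character g = if g = 1 then (Fintype.card G : ℂ) else 0 := by
  rw [Representation.character, LinearMap.trace_eq_matrix_trace ℂ (Pi.basisFun ℂ G)]
  simp [regularRepresentation, Matrix.trace, LinearMap.funLeft, Pi.single_apply]

theorem ncard_conjugatesOf_eq_card_filter (g : G) [DecidablePred (IsConj g)] :
    (conjugatesOf g).ncard = (Finset.univ.filter (IsConj g)).card := by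
  rw [← Set.ncard_coe_finset]
  congr 1
  ext h
  simp [conjugatesOf]

theorem ncard_conjugatesOf_mul_sum_norm_sq_le {C : Finset (G → ℂ)}
    (hC : ∀ χ ∈ C, χ ∈ irreducibleCharacters G) (g : G) :
    (conjugatesOf g).ncard * ∑ χ ∈ C, ‖χ g‖ ^ 2 ≤ (Fintype.card G : ℝ) := by
  classical
  set K := Finset.univ.filter (IsConj g)
  rw [ncard_conjugatesOf_eq_card_filter]
  have hn : (0 : ℝ) < Fintype.card G := by exact_mod_cast Fintype.card_pos
  have hK : (0 : ℝ) < K.card := by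
    exact_mod_cast Finset.card_pos.mpr
      ⟨g, Finset.mem_filter.mpr ⟨Finset.mem_univ g, IsConj.refl g⟩⟩
  set s : ℝ := √(Fintype.card G)
  have hs : s * s = Fintype.card G := Real.mul_self_sqrt hn.le
  have hs0 : s ≠ 0 := (Real.sqrt_pos.mpr hn).ne'
  have hstar : ∀ χ ∈ C, ∀ h, star (χ h) = χ h⁻¹ := by
    intro χ hχ h
    obtain ⟨V, -, rfl⟩ := hC χ hχ
    exact (V.character_inv h).symm
  have hconj : ∀ χ ∈ C, ∀ h ∈ K, χ h = χ g := by
    intro χ hχ h hh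
    obtain ⟨V, -, rfl⟩ := hC χ hχ
    obtain ⟨c, rfl⟩ := isConj_iff.mp (Finset.mem_filter.mp hh).2
    exact V.char_conj g c
  let v : C → EuclideanSpace ℂ G := fun χ ↦ WithLp.toLp 2 fun h ↦ χ.1 h / s
  have hv : Orthonormal ℂ v := by
    rw [orthonormal_iff_ite]
    intro χ ψ
    have h1 : inner ℂ (v χ) (v ψ) = (∑ h, ψ.1 h * χ.1 h⁻¹) / (s * s) := by
      rw [PiLp.inner_apply, Finset.sum_div]
      refine Finset.sum_congr rfl fun h _ ↦ ?_
      rw [← hstar χ.1 χ.2]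
      simp [v]
      ring
    rw [h1, sum_mul_inv_of_mem_irreducibleCharacters (hC _ ψ.2) (hC _ χ.2), ← Complex.ofReal_mul,
      hs]
    have : (Fintype.card G : ℂ) ≠ 0 := by exact_mod_cast hn.ne'
    by_cases h : χ = ψ
    · simp [h, this]
    · rw [if_neg h, if_neg fun h' ↦ h (Subtype.ext h'.symm), zero_div]
  let x : EuclideanSpace ℂ G := WithLp.toLp 2 fun h ↦ if h ∈ K then 1 else 0
  have hx : ‖x‖ ^ 2 = K.card := by
    rw [EuclideanSpace.norm_sq_eq]
    simp [x, apply_ite]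
  have hvx : ∀ χ : C, ‖inner ℂ (v χ) x‖ ^ 2 = K.card ^ 2 / Fintype.card G * ‖χ.1 g‖ ^ 2 := by
    intro χ
    have h1 : inner ℂ (v χ) x = K.card * (star (χ.1 g) / s) := by
      have h2 : ∀ h, inner ℂ ((v χ).ofLp h) (x.ofLp h) =
          if h ∈ K then star (χ.1 g) / (s : ℂ) else 0 := by
        intro h
        by_cases hh : h ∈ K
        · simp [v, x, hh, hconj χ.1 χ.2 h hh]
        · simp [x, hh]
      rw [PiLp.inner_apply, Finset.sum_congr rfl fun h _ ↦ h2 h]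
      simp
    rw [h1, norm_mul, norm_div, norm_star, mul_pow, div_pow, Complex.norm_real, Real.norm_eq_abs,
      sq_abs, sq s, hs, Complex.norm_natCast]
    ring
  have := hv.sum_inner_products_le x (s := Finset.univ)
  simp_rw [hvx, hx] at this
  rw [← Finset.mul_sum, Finset.univ_eq_attach, Finset.sum_attach C fun χ ↦ ‖χ g‖ ^ 2,
    div_mul_eq_mul_div, div_le_iff₀ hn, sq, mul_assoc] at this
  exact le_of_mul_le_mul_left this hK

theorem exists_finset_irreducibleCharacters_sum_sq_eq (G : Type) [Group G] [Fintype G] :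
    ∃ C : Finset (G → ℂ), (∀ χ ∈ C, χ ∈ irreducibleCharacters G) ∧
      ∑ χ ∈ C, ‖χ 1‖ ^ 2 = (Fintype.card G : ℝ) := by
  classical
  obtain ⟨L, hL, hLs⟩ := exists_character_eq_sum_irreducibleCharacters (regularRepresentation G)
  have hC : ∀ χ ∈ L.toFinset, χ ∈ irreducibleCharacters G := fun χ h ↦
    hL χ (Multiset.mem_toFinset.mp h)
  rw [Finset.sum_multiset_count] at hLs
  have hreg : ∀ g, ∑ χ ∈ L.toFinset, L.count χ * χ g =
      if g = 1 then (Fintype.card G : ℂ) else 0 := by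
    intro g
    rw [← regularRepresentation_character, hLs]
    simp
  have hn : (Fintype.card G : ℂ) ≠ 0 := by simp
  have hcount : ∀ χ ∈ L.toFinset, (L.count χ : ℂ) = χ 1 := by
    intro χ hχ
    have h1 : ∑ g, (∑ ψ ∈ L.toFinset, L.count ψ * ψ g) * χ g⁻¹ = Fintype.card G * χ 1 := by
      simp_rw [hreg]
      simp
    simp_rw [Finset.sum_mul] at h1
    rw [Finset.sum_comm] at h1
    simp_rw [mul_assoc, ← Finset.mul_sum] at h1
    rw [Finset.sum_congr rfl fun ψ hψ ↦ by
      rw [sum_mul_inv_of_mem_irreducibleCharacters (hC ψ hψ) (hC χ hχ)]] at h1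
    simp only [mul_ite, mul_zero, Finset.sum_ite_eq', hχ, if_true] at h1
    rw [mul_comm] at h1
    exact mul_left_cancel₀ hn h1
  refine ⟨L.toFinset, hC, ?_⟩
  have h1 := hreg 1
  rw [if_pos rfl] at h1
  have h2 : ∀ χ ∈ L.toFinset, (L.count χ : ℂ) * χ 1 = ((‖χ 1‖ ^ 2 : ℝ) : ℂ) := by
    intro χ hχ
    rw [← hcount χ hχ, Complex.norm_natCast]
    push_cast
    ring
  rw [Finset.sum_congr rfl h2, ← Complex.ofReal_sum] at h1
  exact_mod_cast h1

theorem exists_irreducibleCharacter_sum_norm_pow_four_lt [DecidableEq G]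
    (h : ∑ g ∈ {g : G | g ≠ 1}, 1 / ((conjugatesOf g).ncard * √(conjugatesOf g).ncard) < 1) :
    ∃ χ ∈ irreducibleCharacters G, ∑ g ∈ {g : G | g ≠ 1}, ‖χ g‖ ^ 4 < ‖χ 1‖ ^ 4 := by
  classical
  set c : G → ℝ := fun g ↦ (conjugatesOf g).ncard with hc
  set S : Finset G := {g : G | g ≠ 1} with hS
  have hcpos : ∀ g, 0 < c g := fun g ↦ by
    simp only [hc, Nat.cast_pos]
    exact (Set.ncard_pos (Set.toFinite _)).mpr ⟨g, mem_conjugatesOf_self⟩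
  obtain ⟨C, hC, hCsum⟩ := exists_finset_irreducibleCharacters_sum_sq_eq G
  have hn : (0 : ℝ) < Fintype.card G := by exact_mod_cast Fintype.card_pos
  obtain ⟨χ, hχ, hlt⟩ : ∃ χ ∈ C, ∑ g ∈ S, 1 / √(c g) * ‖χ g‖ ^ 2 < ‖χ 1‖ ^ 2 := by
    refine Finset.exists_lt_of_sum_lt ?_
    rw [hCsum, Finset.sum_comm]
    calc ∑ g ∈ S, ∑ χ ∈ C, 1 / √(c g) * ‖χ g‖ ^ 2
        ≤ ∑ g ∈ S, Fintype.card G * (1 / (c g * √(c g))) := by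
          refine Finset.sum_le_sum fun g _ ↦ ?_
          have h1 := ncard_conjugatesOf_mul_sum_norm_sq_le hC g
          have h2 : ∑ χ ∈ C, ‖χ g‖ ^ 2 ≤ Fintype.card G / c g := by
            rwa [le_div_iff₀' (hcpos g)]
          rw [← Finset.mul_sum]
          calc 1 / √(c g) * ∑ χ ∈ C, ‖χ g‖ ^ 2 ≤ 1 / √(c g) * (Fintype.card G / c g) := by gcongr
            _ = _ := by field_simp
      _ < Fintype.card G := by
          rw [← Finset.mul_sum]
          exact mul_lt_of_lt_one_right hn h
  refine ⟨χ, hC χ hχ, ?_⟩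
  obtain ⟨V, -, hV⟩ := hC χ hχ
  set T := ∑ g ∈ S, 1 / √(c g) * ‖χ g‖ ^ 2
  have hT : 0 ≤ T := Finset.sum_nonneg fun g _ ↦ by positivity
  have hbound : ∀ g ∈ S, ‖χ g‖ ^ 2 ≤ 1 / √(c g) * T := by
    intro g hg
    have hsub : Finset.univ.filter (IsConj g) ⊆ S := by
      intro k hk
      replace hk : IsConj g k := (Finset.mem_filter.mp hk).2
      simp only [hS, Finset.mem_filter, Finset.mem_univ, true_and] at hg ⊢
      rintro rfl
      exact hg (isConj_one_left.mp hk)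
    have h1 : ∑ k ∈ Finset.univ.filter (IsConj g), 1 / √(c k) * ‖χ k‖ ^ 2 ≤ T :=
      Finset.sum_le_sum_of_subset_of_nonneg hsub fun _ _ _ ↦ by positivity
    have h2 : ∀ k ∈ Finset.univ.filter (IsConj g),
        1 / √(c k) * ‖χ k‖ ^ 2 = 1 / √(c g) * ‖χ g‖ ^ 2 := by
      intro k hk
      replace hk : IsConj g k := (Finset.mem_filter.mp hk).2
      have hck : c k = c g := by simp only [hc, hk.conjugatesOf_eq]
      obtain ⟨a, rfl⟩ := isConj_iff.mp hk
      rw [hck, ← hV, V.char_conj]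
    rw [Finset.sum_congr rfl h2, Finset.sum_const, nsmul_eq_mul,
      ← ncard_conjugatesOf_eq_card_filter] at h1
    have hs := Real.sqrt_pos.mpr (hcpos g)
    have h3 : c g * (1 / √(c g) * ‖χ g‖ ^ 2) = √(c g) * ‖χ g‖ ^ 2 := by
      calc c g * (1 / √(c g) * ‖χ g‖ ^ 2)
          = √(c g) * √(c g) * (1 / √(c g) * ‖χ g‖ ^ 2) := by
            rw [Real.mul_self_sqrt (hcpos g).le]
        _ = √(c g) * ‖χ g‖ ^ 2 * (√(c g) / √(c g)) := by ring
        _ = √(c g) * ‖χ g‖ ^ 2 := by rw [div_self hs.ne', mul_one]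
    rw [one_div_mul_eq_div, le_div_iff₀' hs, ← h3]
    exact h1
  calc ∑ g ∈ S, ‖χ g‖ ^ 4 ≤ ∑ g ∈ S, 1 / √(c g) * ‖χ g‖ ^ 2 * T := by
        refine Finset.sum_le_sum fun g hg ↦ ?_
        calc ‖χ g‖ ^ 4 = ‖χ g‖ ^ 2 * ‖χ g‖ ^ 2 := by ring
          _ ≤ ‖χ g‖ ^ 2 * (1 / √(c g) * T) := by gcongr; exact hbound g hg
          _ = _ := by ring
    _ = T * T := by rw [← Finset.sum_mul]
    _ < ‖χ 1‖ ^ 2 * ‖χ 1‖ ^ 2 := mul_self_lt_mul_self hT hlt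
    _ = ‖χ 1‖ ^ 4 := by ring

theorem FDRep.exists_hom_tensor_fourth_power_ne_zero [DecidableEq G] {V W : FDRep ℂ G}
    [Simple W]
    (hV : ∑ g ∈ {g : G | g ≠ 1}, ‖V.character g‖ ^ 4 < ‖V.character 1‖ ^ 4) :
    ∃ f : W ⟶ V ⊗ V ⊗ V ⊗ V, f ≠ 0 := by
  classical
  have := invertibleOfNonzero (NeZero.ne (Nat.card G : ℂ))
  suffices Module.finrank ℂ (W ⟶ V ⊗ V ⊗ V ⊗ V) ≠ 0 from
    Module.finrank_pos_iff_exists_ne_zero.mp (Nat.pos_of_ne_zero this)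
  intro h0
  have hchar := FDRep.scalar_product_char_eq_finrank_equivariant W (V ⊗ V ⊗ V ⊗ V)
  rw [h0, Nat.cast_zero] at hchar
  have hsum := (mul_eq_zero.mp hchar).resolve_left (inv_ne_zero (NeZero.ne _))
  have hpow : ∀ g, (V ⊗ V ⊗ V ⊗ V).character g = V.character g ^ 4 := by
    intro g
    simp only [FDRep.char_tensor, Pi.mul_apply]
    ring
  simp_rw [hpow] at hsum
  have hW : (0 : ℝ) < Module.finrank ℂ W := by
    rw [Nat.cast_pos, Nat.pos_iff_ne_zero]
    intro hW
    have hzero : ∀ g, W.character g = 0 := fun g ↦ by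
      simpa [hW] using W.norm_character_le g
    have := (FDRep.simple_iff_char_is_norm_one W).mp inferInstance
    simp only [hzero, mul_zero, Finset.sum_const_zero] at this
    exact NeZero.ne _ this.symm
  rw [← Finset.sum_filter_add_sum_filter_not _ (· ≠ (1 : G))] at hsum
  have hone : ({g | ¬ g ≠ 1} : Finset G) = {1} := by ext; simp
  rw [hone, Finset.sum_singleton, inv_one] at hsum
  have hle : ‖V.character 1‖ ^ 4 * Module.finrank ℂ W ≤
      (∑ g ∈ {g : G | g ≠ 1}, ‖V.character g‖ ^ 4) * Module.finrank ℂ W := by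
    calc ‖V.character 1‖ ^ 4 * Module.finrank ℂ W
        = ‖V.character 1 ^ 4 * W.character 1‖ := by
          rw [norm_mul, norm_pow, FDRep.char_one W, Complex.norm_natCast]
      _ = ‖∑ g ∈ {g : G | g ≠ 1}, V.character g ^ 4 * W.character g⁻¹‖ := by
          rw [eq_neg_of_add_eq_zero_right hsum, norm_neg]
      _ ≤ ∑ g ∈ {g : G | g ≠ 1}, ‖V.character g‖ ^ 4 * Module.finrank ℂ W := by
          refine norm_sum_le_of_le _ fun g _ ↦ ?_
          rw [norm_mul, norm_pow]
          gcongr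
          exact W.norm_character_le _
      _ = _ := by rw [Finset.sum_mul]
  exact absurd (le_of_mul_le_mul_right hle hW) (not_le.mpr hV)

end Characters

theorem Multiset.prod_mul_prod_factorial_count_le (m : Multiset ℕ) :
    m.prod * ∏ i ∈ m.toFinset, (m.count i).factorial ≤ m.sum ^ m.card := by
  rw [Finset.prod_multiset_count, ← Finset.prod_mul_distrib, ← Multiset.toFinset_sum_count_eq,
    ← Finset.prod_pow_eq_pow_sum]
  refine Finset.prod_le_prod' fun i hi ↦ ?_
  have h1 : m.count i * i ≤ m.sum := by
    rw [Finset.sum_multiset_count m]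
    exact Finset.single_le_sum (f := fun j ↦ m.count j • j) (fun _ _ ↦ Nat.zero_le _) hi
  calc i ^ m.count i * (m.count i).factorial ≤ i ^ m.count i * m.count i ^ m.count i := by
        gcongr
        exact Nat.factorial_le_pow _
    _ = (m.count i * i) ^ m.count i := by rw [← mul_pow, mul_comm]
    _ ≤ m.sum ^ m.count i := by gcongr

theorem pow_mul_factorial_sub_le {n k : ℕ} (hk : k ≤ n) :
    (n : ℝ) ^ k * (n - k).factorial ≤ Real.exp 1 ^ k * n.factorial := by
  induction k generalizing n with
  | zero => simp
  | succ k ih =>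
    obtain ⟨n, rfl⟩ : ∃ l, n = l + 1 := ⟨n - 1, by omega⟩
    have hk' : k ≤ n := by omega
    have h1 : ((n + 1 : ℕ) : ℝ) ^ k ≤ Real.exp 1 * (n : ℝ) ^ k := by
      rcases Nat.eq_zero_or_pos n with rfl | hn
      · obtain rfl : k = 0 := by omega
        simp
      have hn' : (0 : ℝ) < n := by exact_mod_cast hn
      calc ((n + 1 : ℕ) : ℝ) ^ k ≤ (n * Real.exp (1 / n)) ^ k := by
            gcongr
            have := mul_le_mul_of_nonneg_left (Real.add_one_le_exp (1 / (n : ℝ))) hn'.le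
            refine le_trans (le_of_eq ?_) this
            push_cast
            field_simp
            ring
        _ = Real.exp (k / n) * (n : ℝ) ^ k := by
            rw [mul_pow, ← Real.exp_nat_mul, mul_comm, mul_one_div]
        _ ≤ Real.exp 1 * (n : ℝ) ^ k := by
            gcongr
            rw [div_le_one hn']
            exact_mod_cast hk'
    rw [Nat.add_sub_add_right]
    calc ((n + 1 : ℕ) : ℝ) ^ (k + 1) * (n - k).factorial
        = (n + 1 : ℕ) * (((n + 1 : ℕ) : ℝ) ^ k * (n - k).factorial) := by ring
      _ ≤ (n + 1 : ℕ) * (Real.exp 1 * (n : ℝ) ^ k * (n - k).factorial) := by gcongr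
      _ = (n + 1 : ℕ) * Real.exp 1 * ((n : ℝ) ^ k * (n - k).factorial) := by ring
      _ ≤ (n + 1 : ℕ) * Real.exp 1 * (Real.exp 1 ^ k * n.factorial) :=
          mul_le_mul_of_nonneg_left (ih hk') (by positivity)
      _ = Real.exp 1 ^ (k + 1) * (n + 1).factorial := by
          rw [Nat.factorial_succ]
          push_cast
          ring

namespace Equiv.Perm

variable {n : ℕ}

theorem sixteen_pow_le_ncard_conjugatesOf (hn : 2500 ≤ n) (g : Perm (Fin n)) :
    (16 : ℝ) ^ g.support.card ≤ (conjugatesOf g).ncard := by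
  set k := g.support.card
  have hkn : k ≤ n := by simpa using Finset.card_le_univ g.support
  set z := g.cycleType.prod * ∏ i ∈ g.cycleType.toFinset, (g.cycleType.count i).factorial with hz
  have hsum : g.cycleType.sum = k := g.sum_cycleType
  have hcard : 2 * g.cycleType.card ≤ k := by
    rw [← hsum, mul_comm, ← smul_eq_mul]
    exact Multiset.card_nsmul_le_sum fun x hx ↦ two_le_of_mem_cycleType hx
  have hn0 : (0 : ℝ) < n := by exact_mod_cast (by omega : 0 < n)
  have hzle : (z : ℝ) ≤ √n ^ k := by
    have h1 : z ≤ n ^ g.cycleType.card :=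
      (Multiset.prod_mul_prod_factorial_count_le _).trans (Nat.pow_le_pow_left (hsum ▸ hkn) _)
    calc (z : ℝ) ≤ (n : ℝ) ^ g.cycleType.card := by exact_mod_cast h1
      _ = √n ^ (2 * g.cycleType.card) := by rw [pow_mul, Real.sq_sqrt hn0.le]
      _ ≤ √n ^ k := by
        refine pow_le_pow_right₀ ?_ hcard
        rw [Real.one_le_sqrt]
        exact_mod_cast (by omega : 1 ≤ n)
  have hconj := card_isConj_mul_eq g
  rw [hsum, mul_assoc, ← hz, Fintype.card_fin] at hconj
  change (conjugatesOf g).ncard * _ = _ at hconj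
  have hsqrt : 16 * Real.exp 1 ≤ √n := by
    have h1 : (50 : ℝ) ≤ √n := by
      rw [Real.le_sqrt (by norm_num) hn0.le]
      norm_num
      exact_mod_cast hn
    linarith [Real.exp_one_lt_d9]
  have hfac : (0 : ℝ) < (n - k).factorial := by exact_mod_cast Nat.factorial_pos _
  have hsn : 0 < √(n : ℝ) := Real.sqrt_pos.mpr hn0
  have key : (16 : ℝ) ^ k * (Real.exp 1 ^ k * √n ^ k * (n - k).factorial) ≤
      (conjugatesOf g).ncard * (Real.exp 1 ^ k * √n ^ k * (n - k).factorial) := by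
    calc (16 : ℝ) ^ k * (Real.exp 1 ^ k * √n ^ k * (n - k).factorial)
        = (16 * Real.exp 1) ^ k * √n ^ k * (n - k).factorial := by rw [mul_pow]; ring
      _ ≤ √n ^ k * √n ^ k * (n - k).factorial := by gcongr
      _ = (n : ℝ) ^ k * (n - k).factorial := by rw [← mul_pow, Real.mul_self_sqrt hn0.le]
      _ ≤ Real.exp 1 ^ k * n.factorial := pow_mul_factorial_sub_le hkn
      _ = Real.exp 1 ^ k * ((conjugatesOf g).ncard * ((n - k).factorial * z)) := by
          rw [← hconj]
          push_cast
          rfl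
      _ ≤ Real.exp 1 ^ k * ((conjugatesOf g).ncard * ((n - k).factorial * √n ^ k)) := by gcongr
      _ = _ := by ring
  exact le_of_mul_le_mul_right key (by positivity)

theorem sum_inv_ncard_conjugatesOf_le (k : ℕ) :
    ∑ g : Perm (Fin n) with g.support.card = k, 1 / ((conjugatesOf g).ncard : ℝ) ≤ 2 ^ k := by
  classical
  set A : Finset (Perm (Fin n)) := {g | g.support.card = k} with hA
  have hfiber : ∀ g ∈ A,
      (conjugatesOf g).ncard = (A.filter (·.cycleType = g.cycleType)).card := by
    intro g hg
    rw [← Set.ncard_coe_finset]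
    congr 1
    ext h
    have hsupp : h.cycleType = g.cycleType → h.support.card = k := fun hh ↦ by
      rw [← sum_cycleType, hh, sum_cycleType]
      exact (Finset.mem_filter.mp hg).2
    change IsConj g h ↔ _
    simp only [isConj_iff_cycleType_eq, hA, Finset.coe_filter, Finset.mem_filter,
      Finset.mem_univ, true_and, Set.mem_ofPred_eq]
    exact ⟨fun hh ↦ ⟨hsupp hh.symm, hh.symm⟩, fun hh ↦ hh.2.symm⟩
  have himage : A.image cycleType ⊆ Finset.univ.image (Nat.Partition.parts (n := k)) := by
    intro m hm
    obtain ⟨g, hg, rfl⟩ := Finset.mem_image.mp hm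
    exact Finset.mem_image.mpr ⟨⟨g.cycleType,
      fun hi ↦ zero_lt_two.trans_le (two_le_of_mem_cycleType hi),
      g.sum_cycleType.trans (Finset.mem_filter.mp hg).2⟩, Finset.mem_univ _, rfl⟩
  have hcard : (A.image cycleType).card ≤ 2 ^ k :=
    calc (A.image cycleType).card ≤ Fintype.card (Nat.Partition k) :=
          (Finset.card_le_card himage).trans Finset.card_image_le
      _ ≤ Fintype.card (Composition k) :=
          Fintype.card_le_of_surjective _ Nat.Partition.ofComposition_surj
      _ = 2 ^ (k - 1) := composition_card k
      _ ≤ 2 ^ k := Nat.pow_le_pow_right two_pos (Nat.sub_le k 1)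
  calc ∑ g ∈ A, 1 / ((conjugatesOf g).ncard : ℝ)
      = ∑ g ∈ A, 1 / ((A.filter (·.cycleType = g.cycleType)).card : ℝ) :=
        Finset.sum_congr rfl fun g hg ↦ by rw [hfiber g hg]
    _ = ∑ m ∈ A.image cycleType, (A.filter (·.cycleType = m)).card •
          (1 / ((A.filter (·.cycleType = m)).card : ℝ)) :=
        Finset.sum_comp (fun m ↦ 1 / ((A.filter (·.cycleType = m)).card : ℝ)) cycleType
    _ ≤ ∑ m ∈ A.image cycleType, 1 := by
        refine Finset.sum_le_sum fun m _ ↦ ?_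
        rw [nsmul_eq_mul, mul_one_div]
        exact div_self_le_one _
    _ ≤ 2 ^ k := by
        rw [Finset.sum_const, nsmul_one]
        exact_mod_cast hcard

theorem sum_inv_ncard_mul_sqrt_lt_one (hn : 2500 ≤ n) :
    ∑ g ∈ {g : Perm (Fin n) | g ≠ 1},
      1 / ((conjugatesOf g).ncard * √(conjugatesOf g).ncard) < 1 := by
  have hterm : ∀ g : Perm (Fin n), 1 / ((conjugatesOf g).ncard * √(conjugatesOf g).ncard) ≤
      (1 / 4 : ℝ) ^ g.support.card * (1 / ((conjugatesOf g).ncard : ℝ)) := by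
    intro g
    have h1 := sixteen_pow_le_ncard_conjugatesOf hn g
    have h2 : (4 : ℝ) ^ g.support.card ≤ √(conjugatesOf g).ncard := by
      refine Real.le_sqrt_of_sq_le ?_
      rw [← pow_mul, mul_comm, pow_mul]
      norm_num
      exact h1
    rw [one_div_pow, one_div_mul_one_div, mul_comm]
    have : (0 : ℝ) < (conjugatesOf g).ncard := lt_of_lt_of_le (by positivity) h1
    gcongr
  have hmaps : ∀ g ∈ ({g : Perm (Fin n) | g ≠ 1} : Finset _),
      g.support.card ∈ Finset.Ioc 0 n := by
    intro g hg
    rw [Finset.mem_Ioc]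
    refine ⟨Finset.card_pos.mpr ?_, by simpa using Finset.card_le_univ g.support⟩
    rw [Finset.nonempty_iff_ne_empty, Ne, support_eq_empty_iff]
    simpa using hg
  calc _ ≤ ∑ g ∈ {g : Perm (Fin n) | g ≠ 1},
        (1 / 4 : ℝ) ^ g.support.card * (1 / ((conjugatesOf g).ncard : ℝ)) :=
        Finset.sum_le_sum fun g _ ↦ hterm g
    _ = ∑ k ∈ Finset.Ioc 0 n, ∑ g ∈ ({g : Perm (Fin n) | g ≠ 1} : Finset _) with
          g.support.card = k,
          (1 / 4 : ℝ) ^ g.support.card * (1 / ((conjugatesOf g).ncard : ℝ)) :=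
        (Finset.sum_fiberwise_of_maps_to hmaps _).symm
    _ ≤ ∑ k ∈ Finset.Ioc 0 n, (1 / 2 : ℝ) ^ k := by
        refine Finset.sum_le_sum fun k _ ↦ ?_
        calc _ ≤ ∑ g : Perm (Fin n) with g.support.card = k,
              (1 / 4 : ℝ) ^ g.support.card * (1 / ((conjugatesOf g).ncard : ℝ)) :=
              Finset.sum_le_sum_of_subset_of_nonneg
                (Finset.filter_subset_filter _ (Finset.subset_univ _)) fun _ _ _ ↦ by positivity
          _ = (1 / 4 : ℝ) ^ k * ∑ g : Perm (Fin n) with g.support.card = k,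
              1 / ((conjugatesOf g).ncard : ℝ) := by
              rw [Finset.mul_sum]
              refine Finset.sum_congr rfl fun g hg ↦ ?_
              rw [(Finset.mem_filter.mp hg).2]
          _ ≤ (1 / 4 : ℝ) ^ k * 2 ^ k := by
              gcongr
              exact sum_inv_ncard_conjugatesOf_le k
          _ = (1 / 2 : ℝ) ^ k := by rw [← mul_pow]; norm_num
    _ = 1 - (1 / 2 : ℝ) ^ n := by
        clear hmaps hterm hn
        induction n with
        | zero => simp
        | succ n ih =>
          rw [← Finset.insert_Ioc_right_eq_Ioc_add_one (Nat.zero_le n),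
            Finset.sum_insert (by simp), ih]
          ring
    _ < 1 := by simp

end Equiv.Perm

/-- **Theorem (tensor fourth powers).**  For all sufficiently large `n` there is an
irreducible finite-dimensional complex representation `V` of the symmetric group `S_n`
such that every irreducible finite-dimensional complex representation of `S_n` is a
constituent (admits a nonzero equivariant map into) of `V ⊗ V ⊗ V ⊗ V`. -/
theorem tensor_fourth_power_contains_all :
    ∃ N : ℕ, ∀ n : ℕ, N ≤ n →
      ∃ V : FDRep ℂ (Equiv.Perm (Fin n)), Simple V ∧
        ∀ W : FDRep ℂ (Equiv.Perm (Fin n)), Simple W →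
          ∃ f : W ⟶ V ⊗ V ⊗ V ⊗ V, f ≠ 0 := by
  refine ⟨2500, fun n hn ↦ ?_⟩
  obtain ⟨χ, ⟨V, hV, rfl⟩, hlt⟩ := exists_irreducibleCharacter_sum_norm_pow_four_lt
    (Equiv.Perm.sum_inv_ncard_mul_sqrt_lt_one hn)
  exact ⟨V, hV, fun W hW ↦ FDRep.exists_hom_tensor_fourth_power_ne_zero hlt⟩
end

section
/- For every m ≥ 1, setting n = m(m+1)/2, there exists an irreducible finite-dimensional complex representation V of the symmetric group S_n such that every irreducible finite-dimensional complex representation of S_n is a constituent of the tensor power V^{⊗ 2⌈(m+1)/2⌉}. -/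
open CategoryTheory MonoidalCategory

/-- `tpow V k` is the `k`-fold tensor power `V ⊗ ⋯ ⊗ V` in `FDRep ℂ G`
(the empty tensor power being the monoidal unit, i.e. the trivial representation). -/
noncomputable def tpow {G : Type} [Monoid G] (V : FDRep ℂ G) : ℕ → FDRep ℂ G
  | 0 => 𝟙_ (FDRep ℂ G)
  | k + 1 => tpow V k ⊗ V

section TensorPower

variable {G : Type} [Group G]

/-- A linear map commuting with the actions, as a morphism in `FDRep`. -/
noncomputable def FDRep.homOfLinear {V W : FDRep ℂ G} (T : V →ₗ[ℂ] W)
    (hT : ∀ g v, T (V.ρ g v) = W.ρ g (T v)) : V ⟶ W :=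
  ⟨InducedCategory.homMk (ModuleCat.ofHom T), fun g => by
    ext v
    exact hT g v⟩

theorem FDRep.homOfLinear_ne_zero {V W : FDRep ℂ G} {T : V →ₗ[ℂ] W}
    (hT : ∀ g v, T (V.ρ g v) = W.ρ g (T v)) {v : V} (hv : T v ≠ 0) :
    FDRep.homOfLinear T hT ≠ 0 := by
  intro h
  apply hv
  have h2 := congrArg (fun f : V ⟶ W => f.hom.hom.hom v) h
  exact h2

/-- A product of `k` matrix coefficients of `V` is a matrix coefficient of `tpow V k`. -/
theorem exists_matrixCoeff_tpow (V : FDRep ℂ G) (l : ℕ → V →ₗ[ℂ] ℂ) (v : ℕ → V) (k : ℕ) :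
    ∃ (L : tpow V k →ₗ[ℂ] ℂ) (u : tpow V k),
      ∀ g, L ((tpow V k).ρ g u) = ∏ i ∈ Finset.range k, l i (V.ρ g (v i)) := by
  induction k with
  | zero =>
    refine ⟨(LinearMap.id : ℂ →ₗ[ℂ] ℂ), (1 : ℂ), fun g => ?_⟩
    rw [Finset.prod_range_zero]
    rfl
  | succ k ih =>
    obtain ⟨L, u, h⟩ := ih
    refine ⟨(LinearMap.mul' ℂ ℂ ∘ₗ TensorProduct.map L (l k) :
      TensorProduct ℂ (tpow V k) V →ₗ[ℂ] ℂ), (u ⊗ₜ[ℂ] v k : TensorProduct ℂ (tpow V k) V),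
      fun g => ?_⟩
    rw [Finset.prod_range_succ, ← h]
    rfl

theorem exists_hom_ne_zero_of_matrixCoeff [Fintype G] (U W : FDRep ℂ G) [Simple W]
    (L : U →ₗ[ℂ] ℂ) (u : U) (h1 : L (U.ρ 1 u) ≠ 0) (h : ∀ g, g ≠ 1 → L (U.ρ g u) = 0) :
    ∃ f : W ⟶ U, f ≠ 0 := by
  classical
  have hW : ∃ w : W, w ≠ 0 := by
    by_contra! hW
    apply id_nonzero W
    ext w
    exact hW w
  obtain ⟨w, hw⟩ := hW
  obtain ⟨r, hr⟩ : ∃ r : Module.Dual ℂ W, r w ≠ 0 := by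
    by_contra! hr
    exact hw ((Module.forall_dual_apply_eq_zero_iff ℂ w).1 hr)
  let T : W →ₗ[ℂ] U := ∑ g : G, (r ∘ₗ W.ρ g⁻¹).smulRight (U.ρ g u)
  have hT (x : W) : T x = ∑ g : G, r (W.ρ g⁻¹ x) • U.ρ g u := by
    simp [T]
  refine ⟨FDRep.homOfLinear T fun g x => ?_, FDRep.homOfLinear_ne_zero (v := w) _ fun h0 => ?_⟩
  · rw [hT, hT, map_sum, ← Equiv.sum_comp (Equiv.mulLeft g)]
    refine Finset.sum_congr rfl fun y _ => ?_
    rw [map_smul, Equiv.coe_mulLeft, map_mul (U.ρ), Module.End.mul_apply, ← Module.End.mul_apply,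
      ← map_mul, mul_inv_rev, inv_mul_cancel_right]
  · have h2 := congrArg L h0
    rw [hT, map_sum, map_zero, Finset.sum_eq_single 1 (fun g _ hg => by simp [h g hg]) (by simp)]
      at h2
    rw [inv_one, map_one (W.ρ), map_smul, smul_eq_mul] at h2
    exact mul_ne_zero hr h1 h2

theorem exists_hom_tpow_ne_zero [Fintype G] (V W : FDRep ℂ G) [Simple W] (k : ℕ)
    (l : ℕ → V →ₗ[ℂ] ℂ) (v : ℕ → V) (h1 : ∀ i, l i (v i) ≠ 0)
    (h : ∀ g, (∀ i < k, l i (V.ρ g (v i)) ≠ 0) → g = 1) :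
    ∃ f : W ⟶ tpow V k, f ≠ 0 := by
  obtain ⟨L, u, hL⟩ := exists_matrixCoeff_tpow V l v k
  refine exists_hom_ne_zero_of_matrixCoeff _ W L u ?_ fun g hg => ?_
  · rw [hL, Finset.prod_ne_zero_iff]
    intro i _
    simpa using h1 i
  · by_contra h0
    rw [hL] at h0
    exact hg (h g fun i hi => Finset.prod_ne_zero_iff.1 h0 i (Finset.mem_range.2 hi))

end TensorPower

section Permutations

open Equiv

/-- If `g` maps every `B i` into `insert (a i) (B i)` for all `i < k` then `g = 1`. -/
def Rigid {X : Type*} [DecidableEq X] (B : ℕ → Finset X) (a : ℕ → X) (k : ℕ) : Prop :=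
  ∀ g : Perm X, (∀ i < k, ∀ b ∈ B i, g b ∈ insert (a i) (B i)) → g = 1

theorem exists_rigid_three : ∃ (B : ℕ → Finset (Fin 3)) (a : ℕ → Fin 3),
    (∀ i, a i ∉ B i) ∧ (∀ i, (B i).card = (B 0).card) ∧ Rigid B a 4 := by
  let b : Fin 4 → Fin 3 := ![0, 0, 1, 1]
  let a : Fin 4 → Fin 3 := ![1, 2, 0, 2]
  refine ⟨fun i => {b (Fin.ofNat 4 i)}, fun i => a (Fin.ofNat 4 i), fun i => ?_, fun i => rfl, ?_⟩
  · exact (by decide : ∀ j, a j ∉ ({b j} : Finset (Fin 3))) _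
  · intro g hg
    have h (i : Fin 4) : g (b i) = a i ∨ g (b i) = b i := by
      have := hg i i.2 (b i) (by simp)
      simpa using this
    revert g
    suffices ∀ g : Perm (Fin 3), (∀ i, g (b i) = a i ∨ g (b i) = b i) → g = 1 from
      fun g _ h => this g h
    decide

theorem exists_rigid_six : ∃ (B : ℕ → Finset (Fin 6)) (a : ℕ → Fin 6),
    (∀ i, a i ∉ B i) ∧ (∀ i, (B i).card = (B 0).card) ∧ Rigid B a 4 := by
  let b : Fin 4 → Finset (Fin 6) := ![{0, 1}, {1, 2}, {2, 3}, {3, 4}]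
  let a : Fin 4 → Fin 6 := ![3, 4, 0, 1]
  refine ⟨fun i => b (Fin.ofNat 4 i), fun i => a (Fin.ofNat 4 i), fun i => ?_, fun i => ?_, ?_⟩
  · exact (by decide : ∀ j, a j ∉ b j) _
  · exact (by decide : ∀ j j', (b j).card = (b j').card) _ _
  · intro g hg
    have h (i : Fin 4) (x) (hx : x ∈ b i) : g x ∈ insert (a i) (b i) := by
      have := hg i i.2 x (by simpa using hx)
      simpa using this
    have inj {x y : Fin 6} (hxy : x ≠ y) : g x ≠ g y := fun h => hxy (g.injective h)
    have h00 := h 0 0 (by decide)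
    have h01 := h 0 1 (by decide)
    have h11 := h 1 1 (by decide)
    have h12 := h 1 2 (by decide)
    have h22 := h 2 2 (by decide)
    have h23 := h 2 3 (by decide)
    have h33 := h 3 3 (by decide)
    have h34 := h 3 4 (by decide)
    have i1 := inj (x := 0) (y := 1) (by decide)
    have i2 := inj (x := 0) (y := 3) (by decide)
    have i3 := inj (x := 4) (y := 1) (by decide)
    have i4 := inj (x := 4) (y := 3) (by decide)
    have i5 := inj (x := 5) (y := 0) (by decide)
    have i6 := inj (x := 5) (y := 1) (by decide)
    have i7 := inj (x := 5) (y := 2) (by decide)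
    have i8 := inj (x := 5) (y := 3) (by decide)
    have i9 := inj (x := 5) (y := 4) (by decide)
    simp only [a, b, Finset.mem_insert, Finset.mem_singleton, Matrix.cons_val] at *
    have e1 : g 1 = 1 := by omega
    have e2 : g 2 = 2 := by omega
    have e3 : g 3 = 3 := by omega
    have e0 : g 0 = 0 := by omega
    have e4 : g 4 = 4 := by omega
    have e5 : g 5 = 5 := by omega
    ext x : 1
    fin_cases x <;> assumption

theorem exists_rigid_edges {m : ℕ} (hm : 4 ≤ m) :
    ∃ (B : ℕ → Finset (Finset.powersetCard 2 (Finset.univ : Finset (ZMod (m + 1)))))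
      (a : ℕ → Finset.powersetCard 2 (Finset.univ : Finset (ZMod (m + 1)))),
    (∀ i, a i ∉ B i) ∧ (∀ i, (B i).card = (B 0).card) ∧ Rigid B a (m + 1) := by
  have hz (k : ℕ) (h0 : 0 < k) (hk : k < 5) : (k : ZMod (m + 1)) ≠ 0 := by
    rw [Ne, ZMod.natCast_eq_zero_iff]
    exact Nat.not_dvd_of_pos_of_lt h0 (by omega)
  have h1 : (1 : ZMod (m + 1)) ≠ 0 := by exact_mod_cast hz 1 (by norm_num) (by norm_num)
  have h2 : (2 : ZMod (m + 1)) ≠ 0 := by exact_mod_cast hz 2 (by norm_num) (by norm_num)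
  have h3 : (3 : ZMod (m + 1)) ≠ 0 := by exact_mod_cast hz 3 (by norm_num) (by norm_num)
  have h4 : (4 : ZMod (m + 1)) ≠ 0 := by exact_mod_cast hz 4 (by norm_num) (by norm_num)
  let E := Finset.powersetCard 2 (Finset.univ : Finset (ZMod (m + 1)))
  let chord (i : ZMod (m + 1)) : E := ⟨{i - 1, i + 1}, by
    rw [Finset.mem_powersetCard_univ, Finset.card_pair]
    intro h
    exact h2 (by linear_combination -h)⟩
  let star (i : ZMod (m + 1)) : Finset E := {e | i ∈ e.1}
  have mem_star (i : ZMod (m + 1)) (e : E) : e ∈ star i ↔ i ∈ e.1 := by simp [star]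
  have chord_val (i : ZMod (m + 1)) : (chord i).1 = {i - 1, i + 1} := rfl
  have not_mem_chord (i : ZMod (m + 1)) : i ∉ (chord i).1 := by
    rw [chord_val, Finset.mem_insert, Finset.mem_singleton]
    rintro (h | h)
    · exact h1 (by linear_combination h)
    · exact h1 (by linear_combination -h)
  have chord_inj {i j : ZMod (m + 1)} (h : chord i = chord j) : i = j := by
    have hi : i - 1 ∈ (chord j).1 := by rw [← h]; simp [chord_val]
    have hi' : i + 1 ∈ (chord j).1 := by rw [← h]; simp [chord_val]
    simp only [chord_val, Finset.mem_insert, Finset.mem_singleton] at hi hi'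
    rcases hi with hi | hi
    · linear_combination hi
    · rcases hi' with hi' | hi'
      · exact absurd (by linear_combination hi' - hi) h4
      · linear_combination hi'
  have card_star (i : ZMod (m + 1)) : (star i).card = (star 0).card := by
    have key (i : ZMod (m + 1)) :
        (star i)ᶜ.card = (Finset.powersetCard 2 (Finset.univ.erase i)).card := by
      rw [← Finset.card_map (Function.Embedding.subtype _)]
      congr 1
      ext e
      simp [star, E, Finset.mem_powersetCard, Finset.subset_erase, and_comm]
    have hc : (star i)ᶜ.card = (star 0)ᶜ.card := by
      rw [key, key, Finset.card_powersetCard, Finset.card_powersetCard,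
        Finset.card_erase_of_mem (Finset.mem_univ _), Finset.card_erase_of_mem (Finset.mem_univ _)]
    have := Finset.card_add_card_compl (star i)
    have := Finset.card_add_card_compl (star 0)
    omega
  refine ⟨fun i => star i, fun i => chord i, fun i => ?_, fun i => ?_, fun g hg => ?_⟩
  · rw [mem_star]
    exact not_mem_chord _
  · rw [card_star i, card_star ((0 : ℕ) : ZMod (m + 1))]
  · have hg (i : ZMod (m + 1)) (e : E) (he : i ∈ e.1) : g e = chord i ∨ i ∈ (g e).1 := by
      have := hg i.val (ZMod.val_lt i) e (by simpa [mem_star] using he)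
      simpa [mem_star] using this
    have moved (e : E) (he : g e ≠ e) : ∃ i, i ∈ e.1 ∧ g e = chord i ∧
        (e.1 = {i, i - 1} ∨ e.1 = {i, i + 1}) := by
      obtain ⟨i, j, hij, hval⟩ := Finset.card_eq_two.1 (Finset.mem_powersetCard_univ.1 e.2)
      have hi : i ∈ e.1 := by simp [hval]
      have hj : j ∈ e.1 := by simp [hval]
      have of_chord {i j : ZMod (m + 1)} (hj : j ∈ (chord i).1) : j = i - 1 ∨ j = i + 1 := by
        simpa [chord_val] using hj
      rcases hg i e hi with hi' | hi'
      · rcases hg j e hj with hj' | hj'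
        · exact absurd (chord_inj (hi'.symm.trans hj')) hij
        · refine ⟨i, hi, hi', ?_⟩
          rw [hi'] at hj'
          rcases of_chord hj' with h | h <;> simp [hval, h]
      · rcases hg j e hj with hj' | hj'
        · refine ⟨j, hj, hj', ?_⟩
          rw [hj'] at hi'
          rcases of_chord hi' with h | h <;> simp [hval, h, Finset.pair_comm]
        · refine absurd (Subtype.ext ?_) he
          symm
          refine Finset.eq_of_subset_of_card_le ?_ ?_
          · rw [hval]
            simp [Finset.insert_subset_iff, hi', hj']
          · rw [Finset.mem_powersetCard_univ.1 e.2, Finset.mem_powersetCard_univ.1 (g e).2]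
    have fixed (i : ZMod (m + 1)) : g (chord i) = chord i := by
      by_contra h
      obtain ⟨j, -, -, hj⟩ := moved _ h
      have hl : i - 1 ∈ (chord i).1 := by simp [chord_val]
      have hr : i + 1 ∈ (chord i).1 := by simp [chord_val]
      rcases hj with hj | hj <;> rw [hj] at hl hr <;>
        simp only [Finset.mem_insert, Finset.mem_singleton] at hl hr <;>
        rcases hl with hl | hl <;> rcases hr with hr | hr
      · exact h2 (by linear_combination hr - hl)
      · exact h3 (by linear_combination hr - hl)
      · exact h1 (by linear_combination hr - hl)
      · exact h2 (by linear_combination hr - hl)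
      · exact h2 (by linear_combination hr - hl)
      · exact h1 (by linear_combination hr - hl)
      · exact h3 (by linear_combination hr - hl)
      · exact h2 (by linear_combination hr - hl)
    ext e : 1
    by_contra h
    obtain ⟨i, hi, hgi, -⟩ := moved e h
    have : e = chord i := g.injective (hgi.trans (fixed i).symm)
    rw [this] at hi
    exact not_mem_chord i hi

theorem exists_rigid (m : ℕ) (hm : 2 ≤ m) :
    ∃ (B : ℕ → Finset (Fin (m * (m + 1) / 2))) (a : ℕ → Fin (m * (m + 1) / 2)),
    (∀ i, a i ∉ B i) ∧ (∀ i, (B i).card = (B 0).card) ∧ Rigid B a (2 * ((m + 2) / 2)) := by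
  obtain rfl | rfl | hm : m = 2 ∨ m = 3 ∨ 4 ≤ m := by omega
  · exact exists_rigid_three
  · exact exists_rigid_six
  · obtain ⟨B, a, haB, hcard, hr⟩ := exists_rigid_edges hm
    have e : Finset.powersetCard 2 (Finset.univ : Finset (ZMod (m + 1))) ≃
        Fin (m * (m + 1) / 2) := by
      refine Fintype.equivFinOfCardEq ?_
      rw [Fintype.card_coe, Finset.card_powersetCard, Finset.card_univ, ZMod.card,
        Nat.choose_two_right, mul_comm, Nat.add_sub_cancel]
    refine ⟨fun i => (B i).map e.toEmbedding, fun i => e (a i), fun i => ?_, fun i => ?_, ?_⟩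
    · simpa using haB i
    · simpa using hcard i
    · intro g hg
      have h : (e.trans g).trans e.symm = 1 := by
        refine hr _ fun i hi b hb => ?_
        have := hg i (by omega) (e b) (by simpa using hb)
        simpa [Equiv.eq_symm_apply, Equiv.symm_apply_eq] using this
      ext x : 1
      have := DFunLike.congr_fun h (e.symm x)
      simpa using this

section Hook

variable {X : Type} [Fintype X] [DecidableEq X]

/-- The left translation action of a group on its complex-valued functions. -/
def leftTranslation (G : Type) [Group G] : Representation ℂ G (G → ℂ) where
  toFun g := LinearMap.funLeft ℂ ℂ (fun x => g⁻¹ * x)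
  map_one' := by ext; simp [LinearMap.funLeft]
  map_mul' g h := by ext; simp [LinearMap.funLeft, mul_assoc]

theorem leftTranslation_apply {G : Type} [Group G] (g : G) (F : G → ℂ) (x : G) :
    leftTranslation G g F x = F (g⁻¹ * x) := rfl

/-- For `A = insert a B`, the signed sum of the permutations `p * q` with `p` fixing the complement
of `A` and `q` fixing `B`: a Young symmetrizer of hook shape. -/
noncomputable def hookFun (A B : Finset X) (x : Perm X) : ℂ :=
  ∑ p : Perm X with (∀ y ∉ A, p y = y) ∧ ∀ b ∈ B, p b = x b, ((Perm.sign p : ℤ) : ℂ)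

theorem hookFun_mem {A B : Finset X} (hBA : B ⊆ A) {x : Perm X} (hx : hookFun A B x ≠ 0) :
    ∀ b ∈ B, x b ∈ A := by
  intro b hb
  obtain ⟨p, hp, -⟩ := Finset.exists_ne_zero_of_sum_ne_zero hx
  simp only [Finset.mem_filter_univ] at hp
  rw [← hp.2 b hb]
  by_contra h
  have := p.injective (hp.1 _ h)
  exact h (this.symm ▸ hBA hb)

theorem hookFun_one {B : Finset X} {a : X} : hookFun (insert a B) B 1 = 1 := by
  rw [hookFun, Finset.sum_eq_single 1]
  · simp
  · intro p hp hp1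
    simp only [Finset.mem_filter_univ] at hp
    have hfix (y : X) (hy : y ≠ a) : p y = y := by
      by_cases hB : y ∈ B
      · exact hp.2 y hB
      · exact hp.1 y (by simp [hy, hB])
    refine absurd (Equiv.ext fun y => ?_) hp1
    by_cases hy : y = a
    · subst hy
      by_contra h
      exact h (p.injective (hfix _ h))
    · exact hfix y hy
  · simp

theorem hookFun_mul_left (A B : Finset X) {s : Perm X} (hs : ∀ y ∉ A, s y = y) (x : Perm X) :
    hookFun A B (s * x) = ((Perm.sign s : ℤ) : ℂ) * hookFun A B x := by
  rw [hookFun, hookFun, Finset.mul_sum]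
  have hs' (y) (hy : y ∉ A) : s⁻¹ y = y := by
    rw [Perm.inv_eq_iff_eq, hs y hy]
  symm
  refine Finset.sum_bij' (fun p _ => s * p) (fun p _ => s⁻¹ * p) ?_ ?_ ?_ ?_ ?_
  · intro p hp
    rw [Finset.mem_filter_univ] at hp ⊢
    simp only [Perm.mul_apply] at hp ⊢
    exact ⟨fun y hy => by rw [hp.1 y hy, hs y hy], fun b hb => by rw [hp.2 b hb]⟩
  · intro p hp
    rw [Finset.mem_filter_univ] at hp ⊢
    simp only [Perm.mul_apply] at hp ⊢
    exact ⟨fun y hy => by rw [hp.1 y hy, hs' y hy], fun b hb => by rw [hp.2 b hb]; simp⟩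
  · simp
  · simp
  · intro p _
    simp

theorem hookFun_mul_right (A B : Finset X) {q : Perm X} (hq : ∀ b ∈ B, q b = b) (x : Perm X) :
    hookFun A B (x * q) = hookFun A B x := by
  unfold hookFun
  congr 1
  ext p
  rw [Finset.mem_filter_univ, Finset.mem_filter_univ]
  refine and_congr_right fun _ => forall₂_congr fun b hb => ?_
  rw [Perm.mul_apply, hq b hb]

/-- A permutation mapping `B` into `insert a B` agrees on `B` with one supported on `insert a B`. -/
theorem exists_perm_eq_on {B : Finset X} {a : X} (ha : a ∉ B) (x : Perm X)
    (hx : ∀ b ∈ B, x b ∈ insert a B) :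
    ∃ p : Perm X, (∀ y ∉ insert a B, p y = y) ∧ ∀ b ∈ B, p b = x b := by
  let f (y : {y // y ≠ a}) : X := if y.1 ∈ B then x y else y
  have hf : Function.Injective f := by
    intro y z hyz
    simp only [f] at hyz
    split_ifs at hyz with h1 h2 h2
    · exact Subtype.ext (x.injective hyz)
    · exact absurd (hyz ▸ hx _ h1) (by simp [h2, z.2])
    · exact absurd (hyz ▸ hx _ h2) (by simp [h1, y.2])
    · exact Subtype.ext hyz
  classical
  let e : {y // y ≠ a} ≃ {y // y ∈ Set.range f} := Equiv.ofInjective f hf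
  refine ⟨e.extendSubtype, fun y hy => ?_, fun b hb => ?_⟩
  · rw [Finset.mem_insert, not_or] at hy
    rw [e.extendSubtype_apply_of_mem y hy.1]
    simp [e, f, hy.2]
  · rw [e.extendSubtype_apply_of_mem b (fun h => ha (h ▸ hb))]
    simp [e, f, hb]

/-- Up to scalars, `hookFun` is the only function with its symmetries. -/
theorem eq_smul_hookFun {B : Finset X} {a : X} (ha : a ∉ B) (F : Perm X → ℂ)
    (hl : ∀ s : Perm X, (∀ y ∉ insert a B, s y = y) → ∀ x,
      F (s * x) = ((Perm.sign s : ℤ) : ℂ) * F x)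
    (hr : ∀ q : Perm X, (∀ b ∈ B, q b = b) → ∀ x, F (x * q) = F x) :
    F = F 1 • hookFun (insert a B) B := by
  ext x
  rw [Pi.smul_apply, smul_eq_mul]
  by_cases hx : ∀ b ∈ B, x b ∈ insert a B
  · obtain ⟨p, hp, hpx⟩ := exists_perm_eq_on ha x hx
    have hq (b) (hb : b ∈ B) : (p⁻¹ * x) b = b := by
      rw [Perm.mul_apply, Perm.inv_eq_iff_eq, hpx b hb]
    have hx1 : x = p * (1 * (p⁻¹ * x)) := by group
    rw [hx1, hl p hp, hr _ hq, hookFun_mul_left _ _ hp, hookFun_mul_right _ _ hq, hookFun_one]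
    ring
  · have h0 : hookFun (insert a B) B x = 0 := by
      by_contra h
      exact hx (hookFun_mem (Finset.subset_insert a B) h)
    rw [h0, mul_zero]
    push Not at hx
    obtain ⟨b, hb, hxb⟩ := hx
    obtain ⟨u, hu, v, hv, huv⟩ : ∃ u ∈ (insert a B).image x.symm \ B,
        ∃ v ∈ (insert a B).image x.symm \ B, u ≠ v := by
      refine Finset.one_lt_card.1 ?_
      have h1 : ((insert a B).image x.symm).card = B.card + 1 := by
        rw [Finset.card_image_of_injective _ x.symm.injective, Finset.card_insert_of_notMem ha]
      have h2 : ((insert a B).image x.symm ∩ B).card < B.card := by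
        refine Finset.card_lt_card ⟨Finset.inter_subset_right, fun h => hxb ?_⟩
        have := Finset.mem_inter.1 (h hb)
        obtain ⟨y, hy, hyb⟩ := Finset.mem_image.1 this.1
        rwa [← hyb, apply_symm_apply]
      have := Finset.card_sdiff_add_card_inter ((insert a B).image x.symm) B
      omega
    rw [Finset.mem_sdiff, Finset.mem_image] at hu hv
    obtain ⟨⟨u, hu, rfl⟩, huB⟩ := hu
    obtain ⟨⟨v, hv, rfl⟩, hvB⟩ := hv
    have huv' : u ≠ v := fun h => huv (by rw [h])
    have e1 := hr (swap (x.symm u) (x.symm v)) (fun b hb => swap_apply_of_ne_of_ne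
      (fun h => huB (h ▸ hb)) (fun h => hvB (h ▸ hb))) x
    have e2 : x * swap (x.symm u) (x.symm v) = swap u v * x := by
      rw [mul_swap_eq_swap_mul, apply_symm_apply, apply_symm_apply]
    rw [e2, hl _ (fun y hy => swap_apply_of_ne_of_ne (fun h => hy (h ▸ hu))
      (fun h => hy (h ▸ hv))), Perm.sign_swap huv'] at e1
    push_cast at e1
    linear_combination (-1 / 2 : ℂ) * e1

/-- The space spanned by the left translates of `hookFun`. -/
noncomputable def hookSpace (A B : Finset X) : Submodule ℂ (Perm X → ℂ) :=
  Submodule.span ℂ (Set.range fun g => leftTranslation (Perm X) g (hookFun A B))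

theorem leftTranslation_mem_hookSpace {A B : Finset X} (g : Perm X) {F : Perm X → ℂ}
    (hF : F ∈ hookSpace A B) : leftTranslation (Perm X) g F ∈ hookSpace A B := by
  refine Submodule.span_induction ?_ ?_ ?_ ?_ hF
  · rintro _ ⟨h, rfl⟩
    rw [← Module.End.mul_apply, ← map_mul]
    exact Submodule.subset_span ⟨g * h, rfl⟩
  · rw [map_zero]
    exact zero_mem _
  · intro _ _ _ _ h1 h2
    rw [map_add]
    exact add_mem h1 h2
  · intro c _ _ h
    rw [map_smul]
    exact Submodule.smul_mem _ c h

theorem hookSpace_mul_right {A B : Finset X} {F : Perm X → ℂ} (hF : F ∈ hookSpace A B)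
    {q : Perm X} (hq : ∀ b ∈ B, q b = b) (x : Perm X) : F (x * q) = F x := by
  induction hF using Submodule.span_induction with
  | mem _ h =>
    obtain ⟨g, rfl⟩ := h
    simp only [leftTranslation_apply]
    rw [← mul_assoc, hookFun_mul_right _ _ hq]
  | zero => rfl
  | add _ _ _ _ h1 h2 => simp only [Pi.add_apply, h1, h2]
  | smul c _ _ h => simp only [Pi.smul_apply, h]

/-- The representation of `Perm X` on `hookSpace A B`. -/
noncomputable def hookRep (A B : Finset X) : Representation ℂ (Perm X) (hookSpace A B) where
  toFun g := (leftTranslation (Perm X) g).restrict fun _ h => leftTranslation_mem_hookSpace g h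
  map_one' := by ext; simp
  map_mul' g h := by ext; simp

theorem coe_hookRep (A B : Finset X) (g : Perm X) (F : hookSpace A B) :
    (hookRep A B g F : Perm X → ℂ) = leftTranslation (Perm X) g F := rfl

/-- `hookFun` as a vector of `hookSpace`. -/
noncomputable def hookVec (A B : Finset X) : hookSpace A B :=
  ⟨hookFun A B, Submodule.subset_span ⟨1, by simp⟩⟩

theorem span_hookRep_hookVec (A B : Finset X) :
    Submodule.span ℂ (Set.range fun g => hookRep A B g (hookVec A B)) = ⊤ := by
  rw [← Submodule.map_injective_of_injective (hookSpace A B).injective_subtype |>.eq_iff,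
    Submodule.map_span, Submodule.map_subtype_top, ← Set.range_comp]
  rfl

theorem hookRep_endomorphism {B : Finset X} {a : X} (ha : a ∉ B)
    (f : hookSpace (insert a B) B →ₗ[ℂ] hookSpace (insert a B) B)
    (hf : ∀ g v, f (hookRep _ _ g v) = hookRep _ _ g (f v)) :
    ∃ c : ℂ, f = c • LinearMap.id := by
  obtain ⟨c, hc⟩ : ∃ c : ℂ, f (hookVec _ _) = c • hookVec _ _ := by
    refine ⟨(f (hookVec _ _)).1 1, Subtype.ext ?_⟩
    refine eq_smul_hookFun ha _ (fun s hs x => ?_)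
      fun q hq x => hookSpace_mul_right (f (hookVec _ _)).2 hq x
    have hs' : hookRep (insert a B) B s⁻¹ (hookVec _ _) =
        ((Perm.sign s : ℤ) : ℂ) • hookVec (insert a B) B := by
      ext x
      rw [coe_hookRep, leftTranslation_apply, inv_inv]
      exact hookFun_mul_left _ _ hs x
    have h := congrArg (fun F => (f F).1 x) hs'
    simp only [hf, map_smul, coe_hookRep, leftTranslation_apply, inv_inv] at h
    exact h
  refine ⟨c, LinearMap.ext_on_range (span_hookRep_hookVec _ _) fun g => ?_⟩
  rw [hf, hc, map_smul]
  rfl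

theorem simple_hookRep {B : Finset X} {a : X} (ha : a ∉ B) :
    Simple (FDRep.of (hookRep (insert a B) B)) := by
  rw [FDRep.simple_iff_end_is_rank_one]
  refine finrank_eq_one (𝟙 _) ?_ fun f => ?_
  · intro h
    have h1 := congrArg (fun f : FDRep.of (hookRep (insert a B) B) ⟶ _ =>
      (f.hom.hom.hom (hookVec (insert a B) B) : hookSpace (insert a B) B).1 1) h
    exact one_ne_zero (hookFun_one.symm.trans h1)
  · obtain ⟨c, hc⟩ := hookRep_endomorphism ha f.hom.hom.hom fun g v =>
      congrArg (fun t => t.hom.hom v) (f.comm g)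
    refine ⟨c, ?_⟩
    ext v x
    exact (congrArg (fun t => (t v).1 x) hc).symm

theorem exists_perm_image_eq {B C : Finset X} {a c : X} (ha : a ∉ B) (hc : c ∉ C)
    (h : B.card = C.card) : ∃ s : Perm X, (∀ b ∈ B, s b ∈ C) ∧ s a = c := by
  let e : {x // x ∈ B} ≃ {x // x ∈ C} := Finset.equivOfCardEq h
  refine ⟨swap (e.extendSubtype a) c * e.extendSubtype, fun b hb => ?_, by simp⟩
  have hb' := e.extendSubtype_mem b hb
  rw [Perm.mul_apply, swap_apply_of_ne_of_ne]
  · exact hb'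
  · exact fun h => ha (e.extendSubtype.injective h ▸ hb)
  · exact fun h => hc (h ▸ hb')

end Hook

/-- Evaluation at `s` on the hook representation. -/
noncomputable def hookEval {X : Type} [Fintype X] [DecidableEq X] (A B : Finset X) (s : Perm X) :
    FDRep.of (hookRep A B) →ₗ[ℂ] ℂ :=
  (LinearMap.proj s ∘ₗ (hookSpace A B).subtype : hookSpace A B →ₗ[ℂ] ℂ)

theorem hookEval_apply {X : Type} [Fintype X] [DecidableEq X] (A B : Finset X) (s g : Perm X) :
    hookEval A B s ((FDRep.of (hookRep A B)).ρ g (hookRep A B s (hookVec A B))) =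
      hookFun A B (s⁻¹ * (g⁻¹ * s)) := rfl

theorem exists_simple_of_rigid {X : Type} [Fintype X] [DecidableEq X] {B : ℕ → Finset X}
    {a : ℕ → X} {k : ℕ} (ha : ∀ i, a i ∉ B i) (hB : ∀ i, (B i).card = (B 0).card)
    (hr : Rigid B a k) :
    ∃ V : FDRep ℂ (Perm X), Simple V ∧
      ∀ W : FDRep ℂ (Perm X), Simple W → ∃ f : W ⟶ tpow V k, f ≠ 0 := by
  refine ⟨FDRep.of (hookRep (insert (a 0) (B 0)) (B 0)), simple_hookRep (ha 0), fun W _ => ?_⟩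
  choose s hsB hsa using fun i => exists_perm_image_eq (ha 0) (ha i) (hB i).symm
  refine exists_hom_tpow_ne_zero _ W k (fun i => hookEval _ _ (s i))
    (fun i => hookRep _ _ (s i) (hookVec _ _)) (fun i => ?_) fun g hg => ?_
  · have h := hookEval_apply (insert (a 0) (B 0)) (B 0) (s i) 1
    rw [map_one, inv_one, one_mul, inv_mul_cancel, hookFun_one] at h
    exact fun h0 => one_ne_zero (h.symm.trans h0)
  · rw [← inv_eq_one]
    refine hr _ fun i hi b hb => ?_
    have himg : (B 0).image (s i) = B i := by
      refine Finset.eq_of_subset_of_card_le (Finset.image_subset_iff.2 (hsB i)) ?_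
      rw [Finset.card_image_of_injective _ (s i).injective, hB i]
    rw [← himg] at hb ⊢
    obtain ⟨c, hc, rfl⟩ := Finset.mem_image.1 hb
    have h := hookFun_mem (Finset.subset_insert _ _) (hg i hi) c hc
    rw [← hsa i, ← Finset.image_insert]
    exact Finset.mem_image.2 ⟨_, h, by simp⟩

theorem exists_simple_of_subsingleton {G : Type} [Group G] [Fintype G] [Subsingleton G] (k : ℕ) :
    ∃ V : FDRep ℂ G, Simple V ∧ ∀ W : FDRep ℂ G, Simple W → ∃ f : W ⟶ tpow V k, f ≠ 0 := by
  refine ⟨FDRep.of (1 : Representation ℂ G ℂ), ?_, fun W _ => ?_⟩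
  · rw [FDRep.simple_iff_end_is_rank_one]
    refine finrank_eq_one (𝟙 _) ?_ fun f => ⟨f.hom.hom.hom (1 : ℂ), ?_⟩
    · intro h
      have h1 := congrArg (fun f : FDRep.of (1 : Representation ℂ G ℂ) ⟶ _ =>
        (f.hom.hom.hom (1 : ℂ) : ℂ)) h
      exact one_ne_zero h1
    · ext
      exact mul_one _
  · exact exists_hom_tpow_ne_zero _ W k (fun _ => (LinearMap.id : ℂ →ₗ[ℂ] ℂ)) (fun _ => (1 : ℂ))
      (fun _ => one_ne_zero) fun g _ => Subsingleton.elim g 1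

end Permutations

/-- For every `m ≥ 1`, with `n = m(m+1)/2`, there is an irreducible complex representation
`V` of `S_n` such that every irreducible complex representation of `S_n` is a constituent
of the tensor power `V^{⊗ 2⌈(m+1)/2⌉}`.  (Here `⌈(m+1)/2⌉ = (m+2)/2` in natural division.) -/
theorem all_in_power_two_ceil (m : ℕ) (hm : 1 ≤ m) :
    ∃ V : FDRep ℂ (Equiv.Perm (Fin (m * (m + 1) / 2))), Simple V ∧
      ∀ W : FDRep ℂ (Equiv.Perm (Fin (m * (m + 1) / 2))), Simple W →
        ∃ f : W ⟶ tpow V (2 * ((m + 2) / 2)), f ≠ 0 := by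
  obtain rfl | hm : m = 1 ∨ 2 ≤ m := by omega
  · have : Subsingleton (Equiv.Perm (Fin (1 * (1 + 1) / 2))) :=
      inferInstanceAs (Subsingleton (Equiv.Perm (Fin 1)))
    exact exists_simple_of_subsingleton _
  · obtain ⟨B, a, ha, hB, hr⟩ := exists_rigid m hm
    exact exists_simple_of_rigid ha hB hr
end
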